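/- Let γ ∈ (0,2), T > 0 and G ∈ 𝒮. Then lim_{n → ∞} (1/n) · Σ_{x ∈ ℤ} sup_{s ∈ [0,T]} | [−(−Δ)^{γ/2}G](s, (x−1)/n) − [−(−Δ)^{γ/2}G](s, x/n) | = 0. -/

import Mathlib

open MeasureTheory Filter Set ENNReal

/-- Normalizing constant `c_γ = (Σ_{z ≠ 0} |z|^{-γ-1})⁻¹`. -/
noncomputable def cGamma (γ : ℝ) : ℝ :=
  (∑' z : ℤ, if z = 0 then 0 else |(z : ℝ)| ^ (-γ - 1))⁻¹

/-- Transition probability `p(z) = c_γ |z|^{-γ-1}` for `z ≠ 0`, `p(0) = 0`. -/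
noncomputable def transP (γ : ℝ) (z : ℤ) : ℝ :=
  if z = 0 then 0 else cGamma γ * |(z : ℝ)| ^ (-γ - 1)

/-- The space of test functions `𝒮 = P([0,T], C_c^∞(ℝ))`:
functions of the form `G(t,u) = Σ_{j=0}^k t^j G_j(u)` with `G_j` smooth compactly supported. -/
def IsTestS (G : ℝ → ℝ → ℝ) : Prop :=
  ∃ k : ℕ, ∃ Gj : ℕ → ℝ → ℝ,
    (∀ j ≤ k, ContDiff ℝ (⊤ : ℕ∞) (Gj j) ∧ HasCompactSupport (Gj j)) ∧
    ∀ t u : ℝ, G t u = ∑ j ∈ Finset.range (k + 1), t ^ j * Gj j u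

/-- The fractional Laplacian `-(-Δ)^{γ/2}` of a function `G : ℝ → ℝ`, defined as
`c_γ · lim_{ε → 0⁺} ∫_{|u-v| ≥ ε} (G(v) - G(u))/|u-v|^{1+γ} dv`. -/
noncomputable def fracLap (γ : ℝ) (G : ℝ → ℝ) (u : ℝ) : ℝ :=
  cGamma γ * limUnder (nhdsWithin 0 (Set.Ioi 0))
    (fun ε : ℝ => ∫ v in {v : ℝ | ε ≤ |u - v|}, (G v - G u) / |u - v| ^ (1 + γ))

/-- The symmetric second difference of `f` at `u` with step `z`. -/
def secondDiff (f : ℝ → ℝ) (u z : ℝ) : ℝ :=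
  (f (u + z) - f u) - (f u - f (u - z))

/-- A smooth compactly supported function on the line. -/
def IsBump (f : ℝ → ℝ) : Prop :=
  ContDiff ℝ (⊤ : ℕ∞) f ∧ HasCompactSupport f

protected lemma IsBump.deriv {f : ℝ → ℝ} (hf : IsBump f) : IsBump (deriv f) :=
  ⟨(contDiff_infty_iff_deriv.1 hf.1).2, hf.2.deriv⟩

lemma IsBump.continuous {f : ℝ → ℝ} (hf : IsBump f) : Continuous f := hf.1.continuous

lemma IsBump.differentiable {f : ℝ → ℝ} (hf : IsBump f) : Differentiable ℝ f :=
  hf.1.differentiable (by simp)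

lemma IsBump.exists_bound {f : ℝ → ℝ} (hf : IsBump f) : ∃ M, 0 ≤ M ∧ ∀ u, |f u| ≤ M := by
  obtain ⟨M, hM⟩ := hf.2.exists_bound_of_continuous hf.continuous
  exact ⟨M, (norm_nonneg _).trans (hM 0), hM⟩

lemma IsBump.lintegral_ne_top {f : ℝ → ℝ} (hf : IsBump f) : ∫⁻ u, ‖f u‖ₑ ≠ ⊤ :=
  (hf.continuous.integrable_of_hasCompactSupport hf.2).2.ne

lemma IsBump.const_mul {f : ℝ → ℝ} (hf : IsBump f) (c : ℝ) : IsBump (fun u => c * f u) :=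
  ⟨contDiff_const.mul hf.1, hf.2.mul_left⟩

lemma IsBump.sum {s : Finset ℕ} {f : ℕ → ℝ → ℝ} (hf : ∀ j ∈ s, IsBump (f j)) :
    IsBump (fun u => ∑ j ∈ s, f j u) := by
  induction s using Finset.induction_on with
  | empty => exact ⟨by simpa using contDiff_const,
      (HasCompactSupport.zero : HasCompactSupport (0 : ℝ → ℝ))⟩
  | insert a s ha ih =>
    have h1 := hf a (Finset.mem_insert_self _ _)
    have h2 := ih fun j hj => hf j (Finset.mem_insert_of_mem hj)
    simp only [Finset.sum_insert ha]
    exact ⟨h1.1.add h2.1, h1.2.add h2.2⟩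

lemma hasDerivAt_backward_sub {f : ℝ → ℝ} (hf : Differentiable ℝ f) (z v : ℝ) :
    HasDerivAt (fun v => f v - f (v - z)) (deriv f v - deriv f (v - z)) v :=
  (hf v).hasDerivAt.sub ((hf (v - z)).hasDerivAt.comp_sub_const v z)

lemma abs_sub_le_of_deriv_bound {f : ℝ → ℝ} (hf : Differentiable ℝ f) {M : ℝ}
    (hM : ∀ u, |deriv f u| ≤ M) (a b : ℝ) : |f b - f a| ≤ M * |b - a| :=
  convex_univ.norm_image_sub_le_of_norm_deriv_le (fun x _ => hf x) (fun x _ => hM x)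
    (mem_univ a) (mem_univ b)

lemma secondDiff_eq_forward_backward (f : ℝ → ℝ) (u z : ℝ) :
    secondDiff f u z
      = (fun v => f v - f (v - z)) (u + z) - (fun v => f v - f (v - z)) u := by
  simp [secondDiff]

lemma IsBump.exists_secondDiff_bound {f : ℝ → ℝ} (hf : IsBump f) :
    ∃ M, 0 ≤ M ∧ ∀ u z, |secondDiff f u z| ≤ M * min 1 (z ^ 2) := by
  obtain ⟨M, hM0, hM⟩ := hf.exists_bound
  obtain ⟨N, hN0, hN⟩ := hf.deriv.deriv.exists_bound
  refine ⟨4 * M + N, by positivity, fun u z => ?_⟩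
  have h1 : |secondDiff f u z| ≤ 4 * M := by
    have h1 := abs_le.1 (hM (u + z))
    have h2 := abs_le.1 (hM u)
    have h3 := abs_le.1 (hM (u - z))
    rw [secondDiff, abs_le]
    constructor <;> linarith
  have h2 : |secondDiff f u z| ≤ N * z ^ 2 := by
    rw [secondDiff_eq_forward_backward]
    have := abs_sub_le_of_deriv_bound (f := fun v => f v - f (v - z)) (M := N * |z|)
      (fun v => (hasDerivAt_backward_sub hf.differentiable z v).differentiableAt)
      (fun v => by
        rw [(hasDerivAt_backward_sub hf.differentiable z v).deriv]
        simpa using abs_sub_le_of_deriv_bound hf.deriv.differentiable hN (v - z) v) u (u + z)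
    refine this.trans_eq ?_
    rw [add_sub_cancel_left, mul_assoc, abs_mul_abs_self, sq]
  rcases le_total 1 (z ^ 2) with h | h
  · rw [min_eq_left h]; linarith
  · rw [min_eq_right h]; nlinarith [sq_nonneg z]

lemma integrableOn_min_one_sq_div_rpow {γ : ℝ} (hγ : γ ∈ Ioo (0 : ℝ) 2) :
    IntegrableOn (fun z : ℝ => min 1 (z ^ 2) / z ^ (1 + γ)) (Ioi 0) := by
  have hmeas : Measurable (fun z : ℝ => min 1 (z ^ 2) / z ^ (1 + γ)) := by fun_prop
  rw [← Ioc_union_Ioi_eq_Ioi zero_le_one]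
  refine IntegrableOn.union ?_ ?_
  · have h : IntegrableOn (fun z : ℝ => z ^ (1 - γ)) (Ioc 0 1) :=
      (intervalIntegrable_iff_integrableOn_Ioc_of_le zero_le_one).1
        (intervalIntegral.intervalIntegrable_rpow' (by linarith [hγ.2]))
    refine h.mono' hmeas.aestronglyMeasurable ?_
    filter_upwards [ae_restrict_mem measurableSet_Ioc] with z hz
    have hz0 : 0 < z := hz.1
    rw [Real.norm_of_nonneg (by positivity), div_le_iff₀ (by positivity), ← Real.rpow_add hz0,
      show 1 - γ + (1 + γ) = (2 : ℕ) by push_cast; ring, Real.rpow_natCast]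
    exact min_le_right _ _
  · have h : IntegrableOn (fun z : ℝ => z ^ (-(1 + γ))) (Ioi 1) :=
      integrableOn_Ioi_rpow_of_lt (by linarith [hγ.1]) one_pos
    refine h.mono' hmeas.aestronglyMeasurable ?_
    filter_upwards [ae_restrict_mem measurableSet_Ioi] with z hz
    have hz0 : 0 < z := one_pos.trans hz
    rw [Real.norm_of_nonneg (by positivity), Real.rpow_neg hz0.le, ← one_div]
    gcongr
    exact min_le_left _ _

lemma IsBump.integrableOn_secondDiff {f : ℝ → ℝ} (hf : IsBump f) {γ : ℝ}
    (hγ : γ ∈ Ioo (0 : ℝ) 2) (u : ℝ) :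
    IntegrableOn (fun z : ℝ => secondDiff f u z / z ^ (1 + γ)) (Ioi 0) := by
  obtain ⟨M, -, hM⟩ := hf.exists_secondDiff_bound
  have hc := hf.continuous.measurable
  refine ((integrableOn_min_one_sq_div_rpow hγ).const_mul M).mono' ?_ ?_
  · refine Measurable.aestronglyMeasurable ?_
    unfold secondDiff
    fun_prop
  filter_upwards [ae_restrict_mem measurableSet_Ioi] with z hz
  have hz0 : 0 < z := hz
  have hp : 0 < z ^ (1 + γ) := by positivity
  rw [norm_div, Real.norm_of_nonneg hp.le, ← mul_div_assoc]
  gcongr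
  exact hM u z

lemma IsBump.integrable_truncated_difference {f : ℝ → ℝ} (hf : IsBump f) {γ ε : ℝ} (hγ : 0 < γ)
    (hε : 0 < ε) (u : ℝ) :
    Integrable ({z : ℝ | ε ≤ |z|}.indicator fun z => (f (u + z) - f u) / |z| ^ (1 + γ)) := by
  obtain ⟨M, hM0, hM⟩ := hf.exists_bound
  have hc := hf.continuous.measurable
  have hs : MeasurableSet {z : ℝ | ε ≤ |z|} := measurableSet_le measurable_const (by fun_prop)
  have hint : Integrable (fun z : ℝ => (1 + ‖z‖) ^ (-(1 + γ))) :=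
    integrable_one_add_norm (by simpa using hγ)
  refine (hint.const_mul (2 * M * (1 / ε + 1) ^ (1 + γ))).mono' ?_ ?_
  · refine Measurable.aestronglyMeasurable (Measurable.indicator ?_ hs)
    fun_prop
  refine ae_of_all _ fun z => ?_
  by_cases hz : ε ≤ |z|
  · have hz0 : 0 < |z| := hε.trans_le hz
    rw [indicator_of_mem (by exact hz), norm_div,
      Real.norm_of_nonneg (by positivity : 0 ≤ |z| ^ (1 + γ))]
    have h1 : ‖f (u + z) - f u‖ ≤ 2 * M := by
      have := norm_sub_le (f (u + z)) (f u)
      have h1 := hM (u + z)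
      have h2 := hM u
      simp only [Real.norm_eq_abs] at *
      linarith
    have h2 : 1 + ‖z‖ ≤ (1 / ε + 1) * |z| := by
      have : 1 ≤ 1 / ε * |z| := by rw [one_div_mul_eq_div, one_le_div hε]; exact hz
      rw [Real.norm_eq_abs]; linarith
    have h3 : (1 + ‖z‖) ^ (1 + γ) ≤ (1 / ε + 1) ^ (1 + γ) * |z| ^ (1 + γ) := by
      rw [← Real.mul_rpow (by positivity) (by positivity)]
      exact Real.rpow_le_rpow (by positivity) h2 (by linarith)
    have hp : (0 : ℝ) < |z| ^ (1 + γ) := by positivity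
    have hq : (0 : ℝ) < (1 + ‖z‖) ^ (1 + γ) := by positivity
    rw [Real.rpow_neg (by positivity), ← div_eq_mul_inv, div_le_div_iff₀ hp hq]
    calc ‖f (u + z) - f u‖ * (1 + ‖z‖) ^ (1 + γ)
        ≤ 2 * M * ((1 / ε + 1) ^ (1 + γ) * |z| ^ (1 + γ)) := by gcongr
      _ = _ := by ring
  · rw [indicator_of_notMem (by exact hz), norm_zero]
    positivity

lemma IsBump.truncated_integral_eq {f : ℝ → ℝ} (hf : IsBump f) {γ ε : ℝ} (hγ : 0 < γ)
    (hε : 0 < ε) (u : ℝ) :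
    ∫ v in {v : ℝ | ε ≤ |u - v|}, (f v - f u) / |u - v| ^ (1 + γ)
      = ∫ z in Ici ε, secondDiff f u z / z ^ (1 + γ) ∂(volume.restrict (Ioi 0)) := by
  set h : ℝ → ℝ := {z : ℝ | ε ≤ |z|}.indicator fun z => (f (u + z) - f u) / |z| ^ (1 + γ) with hh
  have hi : Integrable h := hf.integrable_truncated_difference hγ hε u
  have hs : MeasurableSet {v : ℝ | ε ≤ |u - v|} := measurableSet_le measurable_const (by fun_prop)
  rw [← integral_indicator hs, ← integral_add_left_eq_self _ u,
    ← integral_indicator measurableSet_Ici]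
  have e1 : (fun z => {v : ℝ | ε ≤ |u - v|}.indicator
      (fun v => (f v - f u) / |u - v| ^ (1 + γ)) (u + z)) = h := by
    funext z
    simp [hh, indicator_apply]
  rw [e1, ← intervalIntegral.integral_Iic_add_Ioi (b := 0) hi.integrableOn hi.integrableOn,
    ← neg_zero, ← integral_comp_neg_Ioi, neg_zero, ← integral_add]
  · refine setIntegral_congr_fun measurableSet_Ioi fun z hz => ?_
    have hz0 : 0 < z := hz
    simp only [hh, indicator_apply, mem_ofPred_eq, abs_neg, abs_of_pos hz0, mem_Ici, secondDiff]
    split_ifs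
    · rw [← sub_eq_add_neg]; ring
    · simp
  · exact hi.comp_neg.integrableOn
  · exact hi.integrableOn

lemma IsBump.fracLap_eq {f : ℝ → ℝ} (hf : IsBump f) {γ : ℝ} (hγ : γ ∈ Ioo (0 : ℝ) 2) (u : ℝ) :
    fracLap γ f u = cGamma γ * ∫ z in Ioi 0, secondDiff f u z / z ^ (1 + γ) := by
  rw [fracLap]
  congr 1
  refine Tendsto.limUnder_eq ?_
  have hcov : AECover (volume.restrict (Ioi (0 : ℝ))) (nhdsWithin (0 : ℝ) (Ioi 0))
      fun ε : ℝ => Ici ε :=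
    aecover_Ioi_of_Ici (tendsto_id.mono_left nhdsWithin_le_nhds)
  refine (hcov.integral_tendsto_of_countably_generated (hf.integrableOn_secondDiff hγ u)).congr' ?_
  filter_upwards [self_mem_nhdsWithin] with ε hε
  exact (hf.truncated_integral_eq hγ.1 hε u).symm

lemma fracLap_sum {s : Finset ℕ} {f : ℕ → ℝ → ℝ} (hf : ∀ j ∈ s, IsBump (f j)) (a : ℕ → ℝ)
    {γ : ℝ} (hγ : γ ∈ Ioo (0 : ℝ) 2) (u : ℝ) :
    fracLap γ (fun u => ∑ j ∈ s, a j * f j u) u = ∑ j ∈ s, a j * fracLap γ (f j) u := by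
  have e : ∀ j ∈ s, a j * fracLap γ (f j) u
      = cGamma γ * ∫ z in Ioi 0, a j * (secondDiff (f j) u z / z ^ (1 + γ)) := fun j hj => by
    rw [(hf j hj).fracLap_eq hγ, integral_const_mul]; ring
  rw [(IsBump.sum fun j hj => (hf j hj).const_mul (a j)).fracLap_eq hγ, Finset.sum_congr rfl e,
    ← Finset.mul_sum, ← integral_finsetSum _
      fun j hj => ((hf j hj).integrableOn_secondDiff hγ u).const_mul (a j)]
  congr 1
  refine integral_congr_ae (ae_of_all _ fun z => ?_)
  simp only [secondDiff, ← Finset.sum_sub_distrib, Finset.sum_div]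
  exact Finset.sum_congr rfl fun j _ => by ring

lemma lintegral_forward_sub_le {g : ℝ → ℝ} (hg : ContDiff ℝ 1 g) {z : ℝ} (hz : 0 ≤ z) :
    ∫⁻ u, ‖g (u + z) - g u‖ₑ ≤ ENNReal.ofReal z * ∫⁻ u, ‖deriv g u‖ₑ := by
  have hd : Measurable (deriv g) := measurable_deriv g
  calc ∫⁻ u, ‖g (u + z) - g u‖ₑ ≤ ∫⁻ u, ∫⁻ t in Icc 0 z, ‖deriv g (u + t)‖ₑ := by
        refine lintegral_mono fun u => ?_
        have hc : ContDiff ℝ 1 (fun t => g (u + t)) := hg.comp (contDiff_const.add contDiff_id)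
        simpa [deriv_comp_const_add] using
          enorm_sub_le_lintegral_deriv_of_contDiffOn_Icc hc.contDiffOn hz
    _ = ∫⁻ t in Icc 0 z, ∫⁻ u, ‖deriv g (u + t)‖ₑ := by
        refine lintegral_lintegral_swap (Measurable.aemeasurable ?_)
        fun_prop
    _ = ENNReal.ofReal z * ∫⁻ u, ‖deriv g u‖ₑ := by
        simp_rw [lintegral_add_right_eq_self (fun u => ‖deriv g u‖ₑ)]
        simp [mul_comm]

lemma IsBump.lintegral_secondDiff_le_sq {f : ℝ → ℝ} (hf : IsBump f) {z : ℝ} (hz : 0 ≤ z) :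
    ∫⁻ u, ‖secondDiff f u z‖ₑ ≤ ENNReal.ofReal (z ^ 2) * ∫⁻ u, ‖deriv (deriv f) u‖ₑ := by
  have hk : ContDiff ℝ 1 (fun v => f v - f (v - z)) :=
    (hf.1.sub (hf.1.comp (contDiff_id.sub contDiff_const))).of_le (by exact_mod_cast le_top)
  simp_rw [secondDiff_eq_forward_backward]
  refine (lintegral_forward_sub_le hk hz).trans ?_
  rw [sq, ENNReal.ofReal_mul hz, mul_assoc]
  gcongr
  have h := lintegral_forward_sub_le (hf.deriv.1.of_le (by exact_mod_cast le_top)) hz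
  rw [← lintegral_sub_right_eq_self _ z] at h
  refine le_of_eq_of_le (lintegral_congr fun v => ?_) h
  rw [(hasDerivAt_backward_sub hf.differentiable z v).deriv, sub_add_cancel]

lemma IsBump.lintegral_secondDiff_le {f : ℝ → ℝ} (hf : IsBump f) (z : ℝ) :
    ∫⁻ u, ‖secondDiff f u z‖ₑ ≤ 4 * ∫⁻ u, ‖f u‖ₑ := by
  have hc := hf.continuous.measurable
  calc ∫⁻ u, ‖secondDiff f u z‖ₑ
      ≤ ∫⁻ u, ((‖f (u + z)‖ₑ + ‖f u‖ₑ) + (‖f u‖ₑ + ‖f (u - z)‖ₑ)) :=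
        lintegral_mono fun u => enorm_sub_le.trans <| add_le_add enorm_sub_le enorm_sub_le
    _ = 4 * ∫⁻ u, ‖f u‖ₑ := by
        rw [lintegral_add_left (by fun_prop), lintegral_add_left (by fun_prop),
          lintegral_add_left (by fun_prop), lintegral_add_right_eq_self (fun u => ‖f u‖ₑ),
          lintegral_sub_right_eq_self (fun u => ‖f u‖ₑ)]
        ring

lemma IsBump.exists_lintegral_secondDiff_bound {f : ℝ → ℝ} (hf : IsBump f) :
    ∃ C : ℝ≥0∞, C ≠ ⊤ ∧ ∀ z, 0 ≤ z →
      ∫⁻ u, ‖secondDiff f u z‖ₑ ≤ C * ENNReal.ofReal (min 1 (z ^ 2)) := by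
  refine ⟨4 * (∫⁻ u, ‖f u‖ₑ) + ∫⁻ u, ‖deriv (deriv f) u‖ₑ,
    ENNReal.add_ne_top.2 ⟨ENNReal.mul_ne_top (by simp) hf.lintegral_ne_top,
      hf.deriv.deriv.lintegral_ne_top⟩, fun z hz => ?_⟩
  rcases le_total 1 (z ^ 2) with h | h
  · rw [min_eq_left h, ENNReal.ofReal_one, mul_one]
    exact (hf.lintegral_secondDiff_le z).trans le_self_add
  · rw [min_eq_right h, mul_comm]
    refine (hf.lintegral_secondDiff_le_sq hz).trans ?_
    gcongr
    exact le_add_self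

lemma tsum_grid_enorm_sub_le {g : ℝ → ℝ} (hg : ContDiff ℝ 1 g) {n : ℕ} (hn : n ≠ 0) :
    ∑' x : ℤ, ‖g (((x : ℝ) - 1) / n) - g ((x : ℝ) / n)‖ₑ ≤ ∫⁻ u, ‖deriv g u‖ₑ := by
  have hdisj : Pairwise (Function.onFun Disjoint
      fun x : ℤ => Ioc (((x : ℝ) - 1) / n) ((x : ℝ) / n)) := by
    have e : ∀ x : ℤ, Ioc (((x : ℝ) - 1) / n) ((x : ℝ) / n)
        = Ioc (-(1 / (n : ℝ)) + x • (1 / (n : ℝ))) (-(1 / (n : ℝ)) + (x + 1) • (1 / (n : ℝ))) := by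
      intro x
      congr 1 <;> rw [zsmul_eq_mul] <;> push_cast <;> ring
    simp_rw [e]
    exact pairwise_disjoint_Ioc_add_zsmul _ _
  calc ∑' x : ℤ, ‖g (((x : ℝ) - 1) / n) - g ((x : ℝ) / n)‖ₑ
      ≤ ∑' x : ℤ, ∫⁻ u in Ioc (((x : ℝ) - 1) / n) ((x : ℝ) / n), ‖deriv g u‖ₑ := by
        refine ENNReal.tsum_le_tsum fun x => ?_
        rw [enorm_sub_rev, setLIntegral_congr Ioc_ae_eq_Icc]
        exact enorm_sub_le_lintegral_deriv_of_contDiffOn_Icc hg.contDiffOn (by gcongr; linarith)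
    _ = ∫⁻ u in ⋃ x : ℤ, Ioc (((x : ℝ) - 1) / n) ((x : ℝ) / n), ‖deriv g u‖ₑ :=
        (lintegral_iUnion (fun _ => measurableSet_Ioc) hdisj _).symm
    _ ≤ ∫⁻ u, ‖deriv g u‖ₑ := setLIntegral_le_lintegral _ _

lemma IsBump.deriv_secondDiff {f : ℝ → ℝ} (hf : IsBump f) (z u : ℝ) :
    deriv (fun u => secondDiff f u z) u = secondDiff (deriv f) u z := by
  have h := hf.differentiable
  exact ((((h (u + z)).hasDerivAt.comp_add_const u z).sub (h u).hasDerivAt).sub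
    ((h u).hasDerivAt.sub ((h (u - z)).hasDerivAt.comp_sub_const u z))).deriv

lemma IsBump.contDiff_secondDiff {f : ℝ → ℝ} (hf : IsBump f) (z : ℝ) :
    ContDiff ℝ 1 (fun u => secondDiff f u z) := by
  have h : ContDiff ℝ 1 f := hf.1.of_le (by exact_mod_cast le_top)
  unfold secondDiff
  fun_prop

/-- The increments of the fractional Laplacian along the grid `ℤ / n` are summable,
uniformly in `n`. -/
lemma IsBump.exists_tsum_fracLap_bound {f : ℝ → ℝ} (hf : IsBump f) {γ : ℝ}
    (hγ : γ ∈ Ioo (0 : ℝ) 2) :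
    ∃ C : ℝ≥0∞, C ≠ ⊤ ∧ ∀ n : ℕ, n ≠ 0 →
      ∑' x : ℤ, ‖fracLap γ f (((x : ℝ) - 1) / n) - fracLap γ f ((x : ℝ) / n)‖ₑ ≤ C := by
  obtain ⟨C, hC, hb⟩ := hf.deriv.exists_lintegral_secondDiff_bound
  have hc := hf.continuous.measurable
  have hm : ∀ u, Measurable (secondDiff f u) := fun u => by unfold secondDiff; fun_prop
  refine ⟨‖cGamma γ‖ₑ * (C * ∫⁻ z in Ioi (0 : ℝ), ‖min 1 (z ^ 2) / z ^ (1 + γ)‖ₑ),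
    ENNReal.mul_ne_top enorm_ne_top
      (ENNReal.mul_ne_top hC (integrableOn_min_one_sq_div_rpow hγ).2.ne), fun n hn => ?_⟩
  simp_rw [hf.fracLap_eq hγ, ← mul_sub, enorm_mul, ENNReal.tsum_mul_left]
  gcongr
  calc ∑' x : ℤ, ‖(∫ z in Ioi 0, secondDiff f (((x : ℝ) - 1) / n) z / z ^ (1 + γ))
          - ∫ z in Ioi 0, secondDiff f ((x : ℝ) / n) z / z ^ (1 + γ)‖ₑ
      ≤ ∑' x : ℤ, ∫⁻ z in Ioi (0 : ℝ),
          ‖secondDiff f (((x : ℝ) - 1) / n) z - secondDiff f ((x : ℝ) / n) z‖ₑ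
            * ‖(z ^ (1 + γ))⁻¹‖ₑ := by
        refine ENNReal.tsum_le_tsum fun x => ?_
        rw [← integral_sub (hf.integrableOn_secondDiff hγ _) (hf.integrableOn_secondDiff hγ _)]
        refine (enorm_integral_le_lintegral_enorm _).trans_eq (lintegral_congr fun z => ?_)
        rw [← enorm_mul, ← div_eq_mul_inv, ← sub_div]
    _ = ∫⁻ z in Ioi (0 : ℝ), (∑' x : ℤ,
          ‖secondDiff f (((x : ℝ) - 1) / n) z - secondDiff f ((x : ℝ) / n) z‖ₑ)
            * ‖(z ^ (1 + γ))⁻¹‖ₑ := by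
        rw [← lintegral_tsum fun x => ?_]
        · simp_rw [ENNReal.tsum_mul_right]
        · have h1 := hm (((x : ℝ) - 1) / n)
          have h2 := hm ((x : ℝ) / n)
          refine Measurable.aemeasurable ?_
          fun_prop
    _ ≤ ∫⁻ z in Ioi (0 : ℝ), C * ‖min 1 (z ^ 2) / z ^ (1 + γ)‖ₑ := by
        refine setLIntegral_mono' measurableSet_Ioi fun z hz => ?_
        have hz0 : (0 : ℝ) < z := hz
        rw [div_eq_mul_inv, enorm_mul, ← mul_assoc]
        gcongr
        refine (tsum_grid_enorm_sub_le (hf.contDiff_secondDiff z) hn).trans ?_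
        simp_rw [hf.deriv_secondDiff]
        rw [Real.enorm_of_nonneg (by positivity)]
        exact hb z hz0.le
    _ = C * ∫⁻ z in Ioi (0 : ℝ), ‖min 1 (z ^ 2) / z ^ (1 + γ)‖ₑ :=
        lintegral_const_mul' _ _ hC

/-- Corollary: discrete gradient of the fractional Laplacian vanishes. -/
theorem statement6 (γ T : ℝ) (hγ : γ ∈ Set.Ioo (0 : ℝ) 2) (hT : 0 < T)
    (G : ℝ → ℝ → ℝ) (hG : IsTestS G) :
    Filter.Tendsto
      (fun n : ℕ =>
        (n : ℝ≥0∞)⁻¹ *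
          ∑' x : ℤ, ⨆ s ∈ Set.Icc (0 : ℝ) T, ENNReal.ofReal
            |fracLap γ (fun u => G s u) (((x : ℝ) - 1) / n)
              - fracLap γ (fun u => G s u) ((x : ℝ) / n)|)
      Filter.atTop (nhds 0) := by
  obtain ⟨k, Gj, hGj, hG⟩ := hG
  have hb : ∀ j ∈ Finset.range (k + 1), IsBump (Gj j) := fun j hj =>
    hGj j (Nat.lt_succ_iff.1 (Finset.mem_range.1 hj))
  have hC : ∀ j, ∃ C : ℝ≥0∞, C ≠ ⊤ ∧ (j ∈ Finset.range (k + 1) → ∀ n : ℕ, n ≠ 0 →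
      ∑' x : ℤ, ‖fracLap γ (Gj j) (((x : ℝ) - 1) / n) - fracLap γ (Gj j) ((x : ℝ) / n)‖ₑ ≤ C) := by
    intro j
    by_cases hj : j ∈ Finset.range (k + 1)
    · obtain ⟨C, hC, h⟩ := (hb j hj).exists_tsum_fracLap_bound hγ
      exact ⟨C, hC, fun _ => h⟩
    · exact ⟨0, by simp, fun h => absurd h hj⟩
  choose C hCtop hC using hC
  set K : ℝ≥0∞ := ∑ j ∈ Finset.range (k + 1), ENNReal.ofReal (T ^ j) * C j
  have hKtop : K ≠ ⊤ :=
    ENNReal.sum_ne_top.2 fun j _ => ENNReal.mul_ne_top ENNReal.ofReal_ne_top (hCtop j)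
  have hlim : Tendsto (fun n : ℕ => (n : ℝ≥0∞)⁻¹ * K) atTop (nhds 0) := by
    simpa using ENNReal.Tendsto.mul_const ENNReal.tendsto_inv_nat_nhds_zero (Or.inr hKtop)
  refine tendsto_of_tendsto_of_tendsto_of_le_of_le' tendsto_const_nhds hlim
    (Eventually.of_forall fun n => zero_le) ?_
  filter_upwards [eventually_ne_atTop 0] with n hn
  gcongr
  have hlin : ∀ s u, fracLap γ (fun u => G s u) u
      = ∑ j ∈ Finset.range (k + 1), s ^ j * fracLap γ (Gj j) u := fun s u => by
    simp_rw [hG]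
    exact fracLap_sum hb (fun j => s ^ j) hγ u
  calc _ ≤ ∑' x : ℤ, ∑ j ∈ Finset.range (k + 1), ENNReal.ofReal (T ^ j)
          * ‖fracLap γ (Gj j) (((x : ℝ) - 1) / n) - fracLap γ (Gj j) ((x : ℝ) / n)‖ₑ := by
        refine ENNReal.tsum_le_tsum fun x => iSup₂_le fun s hs => ?_
        rw [hlin, hlin, ← Finset.sum_sub_distrib, ← Real.enorm_eq_ofReal_abs]
        refine (enorm_sum_le _ _).trans (Finset.sum_le_sum fun j _ => ?_)
        have hs0 : 0 ≤ s := hs.1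
        rw [← mul_sub, enorm_mul, Real.enorm_of_nonneg (by positivity)]
        gcongr
        exact hs.2
    _ = ∑ j ∈ Finset.range (k + 1), ENNReal.ofReal (T ^ j)
          * ∑' x : ℤ, ‖fracLap γ (Gj j) (((x : ℝ) - 1) / n) - fracLap γ (Gj j) ((x : ℝ) / n)‖ₑ := by
        rw [Summable.tsum_finsetSum fun _ _ => ENNReal.summable]
        simp_rw [ENNReal.tsum_mul_left]
    _ ≤ K := Finset.sum_le_sum fun j hj => by
        gcongr
        exact hC j hj n hn
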